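/- arXiv:2112.14670 — 2 statements merged into one kernel-verified Lean document; each statement's English description precedes it below -/
import Mathlib

section
/- Lemma (minimal coset representatives under ascents): Let σ̂ : {1,…,r} → ℤ be weakly decreasing, let J = {j ∈ {1,…,r−1} : σ̂_j = σ̂_{j+1}}, and let W^J = {u ∈ S_r : ℓ(u·s_j) > ℓ(u) for all j ∈ J}. Suppose w ∈ W^J, 1 ≤ i ≤ r−1 and w' ∈ S_r satisfy w = s_i·w' and ℓ(w) = ℓ(w') + 1. Then w' ∈ W^J and (w'σ̂)_i > (w'σ̂)_{i+1}, where (w'σ̂)_k = σ̂_{w'^{−1}(k)}. -/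
noncomputable section

/-- The representative in `{1, …, m}` of a residue class mod `m`:
`rep m x ≡ x (mod m)` and `rep m x ∈ {1, …, m}`. -/
def rep (m : ℕ) (x : ZMod m) : ℕ := (x - 1).val + 1

/-- Indices of adjacent transpositions `s_i` of `S_r` (for `1 ≤ i ≤ r − 1`, stored
0-indexed as `i` with `i + 1 < r`). -/
abbrev AIdx (r : ℕ) := {i : ℕ // i + 1 < r}

def idx0 {r : ℕ} (i : AIdx r) : Fin r := ⟨i.1, Nat.lt_of_succ_lt i.2⟩

def idx1 {r : ℕ} (i : AIdx r) : Fin r := ⟨i.1 + 1, i.2⟩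

/-- The simple reflection `s_i ∈ S_r`, the transposition of `i` and `i + 1`. -/
def sw {r : ℕ} (i : AIdx r) : Equiv.Perm (Fin r) := Equiv.swap (idx0 i) (idx1 i)

/-- The action of `S_r` on `r`-tuples by permuting components: `(u • σ)_i = σ_{u⁻¹(i)}`. -/
def pact {r : ℕ} {X : Type*} (u : Equiv.Perm (Fin r)) (σ : Fin r → X) : Fin r → X :=
  fun k => σ (u⁻¹ k)

/-- The product `s_{i_1} s_{i_2} ⋯ s_{i_k}` of the word `L = [i_1, …, i_k]`. -/
def wordProd {r : ℕ} (L : List (AIdx r)) : Equiv.Perm (Fin r) := (L.map sw).prod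

/-- The length `ℓ(w)` of `w ∈ S_r`: the number of inversions. -/
def invCount {r : ℕ} (w : Equiv.Perm (Fin r)) : ℕ :=
  (Finset.univ.filter fun p : Fin r × Fin r => p.1 < p.2 ∧ w p.2 < w p.1).card

theorem sw_mul_self {r : ℕ} (j : AIdx r) : sw j * sw j = 1 :=
  Equiv.swap_mul_self _ _

/-- `s_j` preserves the order of every pair `a < b` other than `(j, j + 1)`. -/
theorem sw_lt_sw {r : ℕ} (j : AIdx r) {a b : Fin r} (hab : a < b)
    (h : ¬(a = idx0 j ∧ b = idx1 j)) : sw j a < sw j b := by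
  simp only [sw, Equiv.swap_apply_def, idx0, idx1, Fin.ext_iff, Fin.lt_def] at *
  split_ifs <;> (try simp only) <;> omega

theorem invCount_lt_mul_sw {r : ℕ} (u : Equiv.Perm (Fin r)) (j : AIdx r)
    (h : u (idx0 j) < u (idx1 j)) : invCount u < invCount (u * sw j) := by
  have hss (x : Fin r) : sw j (sw j x) = x := by
    rw [← Equiv.Perm.mul_apply, sw_mul_self, Equiv.Perm.one_apply]
  have h0 : sw j (idx0 j) = idx1 j := Equiv.swap_apply_left _ _
  have h1 : sw j (idx1 j) = idx0 j := Equiv.swap_apply_right _ _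
  have h01 : idx0 j < idx1 j := Fin.lt_def.2 (Nat.lt_succ_self _)
  unfold invCount
  rw [← Finset.card_map (Equiv.prodCongr (sw j) (sw j)).toEmbedding]
  apply Finset.card_lt_card
  rw [Finset.ssubset_iff_of_subset]
  · refine ⟨(idx0 j, idx1 j), Finset.mem_filter.2 ⟨Finset.mem_univ _, h01, ?_⟩, ?_⟩
    · simpa only [Equiv.Perm.mul_apply, h0, h1] using h
    · simp only [Finset.mem_map, Finset.mem_filter, not_exists, not_and]
      rintro ⟨a, b⟩ ⟨-, hab, -⟩ he
      simp only [Equiv.coe_toEmbedding, Equiv.prodCongr_apply, Prod.map_apply,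
        Prod.mk.injEq] at he
      have ha : a = idx1 j := by rw [← h0, ← he.1, hss]
      have hb : b = idx0 j := by rw [← h1, ← he.2, hss]
      exact lt_asymm h01 (ha ▸ hb ▸ hab)
  · intro p hp
    simp only [Finset.mem_map, Finset.mem_filter] at hp
    obtain ⟨⟨a, b⟩, ⟨-, hab, hu⟩, rfl⟩ := hp
    refine Finset.mem_filter.2 ⟨Finset.mem_univ _, sw_lt_sw j hab ?_,
      by simpa [hss] using hu⟩
    rintro ⟨rfl, rfl⟩
    exact lt_asymm h hu

theorem invCount_lt_mul_sw_iff {r : ℕ} (u : Equiv.Perm (Fin r)) (j : AIdx r) :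
    invCount u < invCount (u * sw j) ↔ u (idx0 j) < u (idx1 j) := by
  refine ⟨fun h => ?_, invCount_lt_mul_sw u j⟩
  by_contra hn
  have h01 : idx1 j ≠ idx0 j := by simp [idx0, idx1, Fin.ext_iff]
  have hlt : u (idx1 j) < u (idx0 j) :=
    lt_of_le_of_ne (not_lt.1 hn) (u.injective.ne h01)
  have := invCount_lt_mul_sw (u * sw j) j (by simpa [sw] using hlt)
  rw [mul_assoc, sw_mul_self, mul_one] at this
  exact lt_asymm h this

theorem invCount_inv {r : ℕ} (u : Equiv.Perm (Fin r)) : invCount u⁻¹ = invCount u := by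
  unfold invCount
  refine Finset.card_bij' (fun p _ => (u⁻¹ p.2, u⁻¹ p.1)) (fun p _ => (u p.2, u p.1))
    ?_ ?_ ?_ ?_ <;> simp +contextual

theorem invCount_lt_sw_mul_iff {r : ℕ} (u : Equiv.Perm (Fin r)) (j : AIdx r) :
    invCount u < invCount (sw j * u) ↔ u⁻¹ (idx0 j) < u⁻¹ (idx1 j) := by
  rw [← invCount_lt_mul_sw_iff, invCount_inv, ← invCount_inv (sw j * u), mul_inv_rev]
  simp [sw]

/-- A function that increases at each step where the antitone `σ` is constant is increasing
on every pair of points where `σ` takes the same value. -/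
theorem lt_of_antitone_eq {r : ℕ} {α β : Type*} [PartialOrder α] [Preorder β]
    {σ : Fin r → α} (hσ : Antitone σ) {f : Fin r → β}
    (hf : ∀ j : AIdx r, σ (idx0 j) = σ (idx1 j) → f (idx0 j) < f (idx1 j))
    {a b : Fin r} (hab : a < b) (h : σ a = σ b) : f a < f b := by
  obtain ⟨b, hb⟩ := b
  induction b with
  | zero => exact absurd hab (Nat.not_lt_zero _)
  | succ n ih =>
    have hn : n < r := Nat.lt_of_succ_lt hb
    have han : a ≤ ⟨n, hn⟩ := Fin.le_def.2 (Nat.le_of_lt_succ hab)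
    have hn1 : (⟨n, hn⟩ : Fin r) ≤ ⟨n + 1, hb⟩ := Fin.le_def.2 (Nat.le_succ n)
    have hσn : σ a = σ ⟨n, hn⟩ := le_antisymm (h.trans_le (hσ hn1)) (hσ han)
    have hstep : f ⟨n, hn⟩ < f ⟨n + 1, hb⟩ := hf ⟨n, hb⟩ (hσn.symm.trans h)
    rcases han.eq_or_lt with rfl | hlt
    · exact hstep
    · exact (ih hn hlt hσn).trans hstep

/-- minimal coset representatives under ascents: let `σ̂` be weakly
decreasing, `J = {j : σ̂_j = σ̂_{j+1}}` and `W^J = {u : ℓ(u s_j) > ℓ(u) for all j ∈ J}`.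
If `w ∈ W^J`, `w = s_i w'` and `ℓ(w) = ℓ(w') + 1`, then `w' ∈ W^J` and
`(w'σ̂)_i > (w'σ̂)_{i+1}`. -/
theorem minimal_coset_representative_ascent
    (r : ℕ) (σhat : Fin r → ℤ) (hanti : Antitone σhat)
    (w w' : Equiv.Perm (Fin r)) (i : ℕ) (hi : i + 1 < r)
    (hWJ : ∀ (j : ℕ) (hj : j + 1 < r),
      σhat ⟨j, Nat.lt_of_succ_lt hj⟩ = σhat ⟨j + 1, hj⟩ →
      invCount w < invCount (w * sw ⟨j, hj⟩))
    (hfac : w = sw ⟨i, hi⟩ * w')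
    (hlen : invCount w = invCount w' + 1) :
    (∀ (j : ℕ) (hj : j + 1 < r),
      σhat ⟨j, Nat.lt_of_succ_lt hj⟩ = σhat ⟨j + 1, hj⟩ →
      invCount w' < invCount (w' * sw ⟨j, hj⟩)) ∧
    σhat (w'⁻¹ ⟨i + 1, hi⟩) < σhat (w'⁻¹ ⟨i, Nat.lt_of_succ_lt hi⟩) := by
  have hw (j : AIdx r) (hj : σhat (idx0 j) = σhat (idx1 j)) : w (idx0 j) < w (idx1 j) :=
    (invCount_lt_mul_sw_iff w j).1 (hWJ j.1 j.2 hj)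
  have hasc : w'⁻¹ (idx0 ⟨i, hi⟩) < w'⁻¹ (idx1 ⟨i, hi⟩) :=
    (invCount_lt_sw_mul_iff w' ⟨i, hi⟩).1 (by rw [← hfac]; omega)
  have hw' : w' = sw ⟨i, hi⟩ * w := by rw [hfac, ← mul_assoc, sw_mul_self, one_mul]
  refine ⟨fun j hj hJ => ?_, lt_of_le_of_ne (hanti hasc.le) fun heq => ?_⟩
  · rw [invCount_lt_mul_sw_iff]
    have hlt := hw ⟨j, hj⟩ hJ
    rw [hw', Equiv.Perm.mul_apply, Equiv.Perm.mul_apply]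
    refine sw_lt_sw _ hlt ?_
    rintro ⟨h0, h1⟩
    have e0 : w'⁻¹ (idx1 ⟨i, hi⟩) = idx0 ⟨j, hj⟩ := by
      rw [Equiv.Perm.inv_eq_iff_eq, hw', Equiv.Perm.mul_apply, h0]
      exact (Equiv.swap_apply_left _ _).symm
    have e1 : w'⁻¹ (idx0 ⟨i, hi⟩) = idx1 ⟨j, hj⟩ := by
      rw [Equiv.Perm.inv_eq_iff_eq, hw', Equiv.Perm.mul_apply, h1]
      exact (Equiv.swap_apply_right _ _).symm
    rw [e0, e1] at hasc
    exact absurd hasc (by simp [idx0, idx1, Fin.lt_def])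
  · have hlt := lt_of_antitone_eq hanti hw hasc heq.symm
    have hinv (x : Fin r) : w (w'⁻¹ x) = sw ⟨i, hi⟩ x := by simp [hfac]
    rw [hinv, hinv, sw, Equiv.swap_apply_left, Equiv.swap_apply_right] at hlt
    exact absurd hlt (by simp [idx0, idx1, Fin.lt_def])
end
end

section
/- Unfused RTT Yang–Baxter equation (Theorem B): for every m ≥ 1, every q, Φ ∈ ℂ* and α as specified, every ℓ ∈ {1,…,m}, every z₁, z₂ ∈ ℂ*, and all boundary spins a, b, d, e ∈ {+, c_1, …, c_m} and c, f ∈ {+, c_ℓ}: ∑_{i, j ∈ {+,c_1,…,c_m}} ∑_{k ∈ {+, c_ℓ}} R^{(ℓ)}(z₁,z₂)(a,b;i,j) · wt_ℓ^{z₁}(i,c,d,k) · wt_ℓ^{z₂}(j,k,e,f) = ∑_{l, m' ∈ {+,c_1,…,c_m}} ∑_{n ∈ {+, c_ℓ}} wt_ℓ^{z₂}(b,c,l,n) · wt_ℓ^{z₁}(a,n,m',f) · R^{(ℓ')}(z₁,z₂)(m',l;d,e), where ℓ' ∈ {1,…,m} with ℓ' ≡ ℓ+1 (mod m). -/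
noncomputable section

/-- A spin: either `+` (`none`) or a color `c_i` represented by the residue class
`i mod m` of its index `i ∈ {1, …, m}` (`some` of that class). -/
abbrev Spin (m : ℕ) := Option (ZMod m)

/-- Boltzmann weight of a T-vertex with column color (class) `j` and row parameter `z`,
on the spins `(a, b, c, d)` of its (left, top, right, bottom) edges; inadmissible
configurations get weight `0`. -/
def wt (m : ℕ) (q Φ : ℂ) (α : ZMod m → ZMod m → ℂ) (j : ZMod m) (z : ℂ) :
    Spin m → Spin m → Spin m → Spin m → ℂ
  | some a, some b, some c, some d =>
      if b = j ∧ d = j ∧ c = a then (if a = j then Φ * q * z else Φ * α (-a) (-j)) else 0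
  | none, some b, none, some d => if b = j ∧ d = j then -Φ / q else 0
  | some a, none, some c, none => if c = a then (if a = j then z else 1) else 0
  | some a, none, none, some d => if a = j ∧ d = j then -(Φ / q) * (1 - q ^ 2) * z else 0
  | none, some b, some c, none => if b = j ∧ c = j then 1 else 0
  | none, none, none, none => 1
  | _, _, _, _ => 0

/-- The unfused R-matrix `R^{(ℓ)}(z₁, z₂)(a, b; c, d)` at vertex color `c_ℓ`, where `a`
is the input spin on the `z₁`-line, `b` the input on the `z₂`-line, `c` the output on
the `z₁`-line and `d` the output on the `z₂`-line; colors are compared via their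
representatives in `{1, …, m}`. -/
def Runf (m : ℕ) (q Φ : ℂ) (α : ZMod m → ZMod m → ℂ) (l : ZMod m) (z1 z2 : ℂ) :
    Spin m → Spin m → Spin m → Spin m → ℂ
  | none, none, none, none => z1 - q ^ 2 * z2
  | some a, some b, some c, some d =>
      if a = b then (if c = a ∧ d = a then z2 - q ^ 2 * z1 else 0)
      else if c = b ∧ d = a then
        (1 - q ^ 2) *
          (if (rep m a < rep m b ∧ rep m b < rep m l) ∨
              (rep m l ≤ rep m a ∧ rep m a < rep m b) ∨
              (rep m b < rep m l ∧ rep m l ≤ rep m a) then z1 else z2)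
      else if c = a ∧ d = b then -q * (z1 - z2) * α (-a) (-b)
      else 0
  | some a, none, none, some d => if d = a then (1 - q ^ 2) * z1 else 0
  | none, some b, some c, none => if c = b then (1 - q ^ 2) * z2 else 0
  | none, some b, none, some d => if d = b then -q * (z1 - z2) * Φ else 0
  | some a, none, some c, none => if c = a then -q * (z1 - z2) / Φ else 0
  | _, _, _, _ => 0

theorem rep_le (m : ℕ) [NeZero m] (x : ZMod m) : rep m x ≤ m :=
  ZMod.val_lt (x - 1)

theorem rep_inj (m : ℕ) [NeZero m] {x y : ZMod m} : rep m x = rep m y ↔ x = y := by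
  simp [rep, (ZMod.val_injective m).eq_iff]

theorem rep_add_one (m : ℕ) [NeZero m] (x : ZMod m) :
    rep m (x + 1) = if rep m x = m then 1 else rep m x + 1 := by
  have h : x + 1 - 1 = (x - 1) + 1 := by ring
  have hlt := ZMod.val_lt (x - 1)
  unfold rep
  rw [h]
  split_ifs with hm
  · rw [ZMod.val_add, ZMod.val_one_eq_one_mod, Nat.add_mod_mod, hm, Nat.mod_self]
  · rw [ZMod.val_add, ZMod.val_one_eq_one_mod, Nat.add_mod_mod, Nat.mod_eq_of_lt (by omega)]

/-- The cyclic order condition selecting `z₁` in the color-exchange weight of `Runf`. -/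
def Precedes (m : ℕ) (l a b : ZMod m) : Prop :=
  (rep m a < rep m b ∧ rep m b < rep m l) ∨
    (rep m l ≤ rep m a ∧ rep m a < rep m b) ∨
    (rep m b < rep m l ∧ rep m l ≤ rep m a)

instance (m : ℕ) (l a b : ZMod m) : Decidable (Precedes m l a b) :=
  inferInstanceAs (Decidable (_ ∨ _ ∨ _))

theorem precedes_add_one_iff (m : ℕ) [NeZero m] {l a b : ZMod m} (ha : a ≠ l) (hb : b ≠ l) :
    Precedes m (l + 1) a b ↔ Precedes m l a b := by
  have h1 := (rep_inj m).not.2 ha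
  have h2 := (rep_inj m).not.2 hb
  have h3 := rep_le m a
  have h4 := rep_le m b
  have h5 : 0 < rep m a := Nat.succ_pos _
  have h6 : 0 < rep m b := Nat.succ_pos _
  unfold Precedes
  rw [rep_add_one]
  split_ifs <;> omega

theorem precedes_self_left (m : ℕ) [NeZero m] {l b : ZMod m} (hb : b ≠ l) :
    Precedes m l l b := by
  have := (rep_inj m).not.2 hb
  unfold Precedes
  omega

theorem not_precedes_self_right (m : ℕ) {l a : ZMod m} : ¬ Precedes m l a l := by
  unfold Precedes
  omega

theorem not_precedes_add_one_left (m : ℕ) [NeZero m] {l b : ZMod m} (hb : b ≠ l) :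
    ¬ Precedes m (l + 1) l b := by
  have h2 := (rep_inj m).not.2 hb
  have h4 := rep_le m b
  have h6 : 0 < rep m b := Nat.succ_pos _
  unfold Precedes
  rw [rep_add_one]
  split_ifs <;> omega

theorem precedes_add_one_right (m : ℕ) [NeZero m] {l a : ZMod m} (ha : a ≠ l) :
    Precedes m (l + 1) a l := by
  have h2 := (rep_inj m).not.2 ha
  have h4 := rep_le m a
  have h6 : 0 < rep m a := Nat.succ_pos _
  unfold Precedes
  rw [rep_add_one]
  split_ifs <;> omega

theorem Runf_colors (m : ℕ) (q Φ : ℂ) (α : ZMod m → ZMod m → ℂ) (l : ZMod m) (z1 z2 : ℂ)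
    {a b : ZMod m} (hab : a ≠ b) (c d : ZMod m) :
    Runf m q Φ α l z1 z2 (some a) (some b) (some c) (some d) =
      (if c = b ∧ d = a then (1 - q ^ 2) * (if Precedes m l a b then z1 else z2) else 0) +
        if c = a ∧ d = b then -q * (z1 - z2) * α (-a) (-b) else 0 := by
  unfold Runf
  simp only [if_neg hab]
  by_cases h : c = b ∧ d = a
  · obtain ⟨rfl, rfl⟩ := h
    simp only [and_self, if_true, Ne.symm hab, false_and, if_false, add_zero]
    rfl
  · simp only [if_neg h, zero_add]

theorem Runf_self (m : ℕ) (q Φ : ℂ) (α : ZMod m → ZMod m → ℂ) (l : ZMod m) (z1 z2 : ℂ)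
    (a c d : ZMod m) :
    Runf m q Φ α l z1 z2 (some a) (some a) (some c) (some d) =
      if c = a ∧ d = a then z2 - q ^ 2 * z1 else 0 := by
  simp [Runf]

section Sums

variable (m : ℕ) [NeZero m] (q Φ : ℂ) (α : ZMod m → ZMod m → ℂ) (l : ZMod m) (z1 z2 : ℂ)

theorem sum_Runf_none_none (F : Spin m → Spin m → ℂ) :
    ∑ i, ∑ j, Runf m q Φ α l z1 z2 none none i j * F i j = (z1 - q ^ 2 * z2) * F none none := by
  simp [Fintype.sum_option, Runf]

theorem sum_Runf_some_none (a : ZMod m) (F : Spin m → Spin m → ℂ) :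
    ∑ i, ∑ j, Runf m q Φ α l z1 z2 (some a) none i j * F i j =
      (1 - q ^ 2) * z1 * F none (some a) + -q * (z1 - z2) / Φ * F (some a) none := by
  simp [Fintype.sum_option, Runf, ite_mul]

theorem sum_Runf_none_some (b : ZMod m) (F : Spin m → Spin m → ℂ) :
    ∑ i, ∑ j, Runf m q Φ α l z1 z2 none (some b) i j * F i j =
      -q * (z1 - z2) * Φ * F none (some b) + (1 - q ^ 2) * z2 * F (some b) none := by
  simp [Fintype.sum_option, Runf, ite_mul]

theorem sum_Runf_some_self (a : ZMod m) (F : Spin m → Spin m → ℂ) :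
    ∑ i, ∑ j, Runf m q Φ α l z1 z2 (some a) (some a) i j * F i j =
      (z2 - q ^ 2 * z1) * F (some a) (some a) := by
  simp [Fintype.sum_option, Runf, ite_mul, ite_and]

theorem sum_Runf_some_some {a b : ZMod m} (hab : a ≠ b) (F : Spin m → Spin m → ℂ) :
    ∑ i, ∑ j, Runf m q Φ α l z1 z2 (some a) (some b) i j * F i j =
      (1 - q ^ 2) * (if Precedes m l a b then z1 else z2) * F (some b) (some a) +
        -q * (z1 - z2) * α (-a) (-b) * F (some a) (some b) := by
  have h1 : ∀ d, Runf m q Φ α l z1 z2 (some a) (some b) none d = 0 := by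
    intro d; cases d <;> simp [Runf]
  have h2 : ∀ c, Runf m q Φ α l z1 z2 (some a) (some b) c none = 0 := by
    intro c; cases c <;> simp [Runf]
  simp only [Fintype.sum_option, h1, h2, Runf_colors m q Φ α l z1 z2 hab]
  simp [add_mul, ite_mul, Finset.sum_add_distrib, ite_and]

/-- The bottom spin of a vertex with column color `l` is `+` or `c_l`. -/
theorem sum_wt_bottom (z : ℂ) (a c d : Spin m) (F : Spin m → ℂ) :
    ∑ k, wt m q Φ α l z a c d k * F k =
      wt m q Φ α l z a c d none * F none + wt m q Φ α l z a c d (some l) * F (some l) := by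
  rw [Fintype.sum_option, Fintype.sum_eq_single l]
  intro k hk
  cases a <;> cases c <;> cases d <;> simp [wt, hk]

theorem sum_wt_right_none (z : ℂ) (c f : Spin m) (F : Spin m → ℂ) :
    ∑ y, wt m q Φ α l z none c y f * F y =
      wt m q Φ α l z none c none f * F none + wt m q Φ α l z none c (some l) f * F (some l) := by
  rw [Fintype.sum_option, Fintype.sum_eq_single l]
  intro y hy
  cases c <;> cases f <;> simp [wt, hy]

theorem sum_wt_right_some (z : ℂ) (a : ZMod m) (c f : Spin m) (F : Spin m → ℂ) :
    ∑ y, wt m q Φ α l z (some a) c y f * F y =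
      wt m q Φ α l z (some a) c none f * F none +
        wt m q Φ α l z (some a) c (some a) f * F (some a) := by
  rw [Fintype.sum_option, Fintype.sum_eq_single a]
  intro y hy
  cases c <;> cases f <;> simp [wt, hy]

theorem sum_wt_none_none (z : ℂ) (G : Spin m → Spin m → ℂ) :
    ∑ x, ∑ n, wt m q Φ α l z none none x n * G x n = G none none := by
  simp [Fintype.sum_option, wt]

theorem sum_wt_none_some (z : ℂ) (G : Spin m → Spin m → ℂ) :
    ∑ x, ∑ n, wt m q Φ α l z none (some l) x n * G x n =
      -Φ / q * G none (some l) + G (some l) none := by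
  simp [Fintype.sum_option, wt, ite_mul]

theorem sum_wt_some_none (z : ℂ) (a : ZMod m) (G : Spin m → Spin m → ℂ) :
    ∑ x, ∑ n, wt m q Φ α l z (some a) none x n * G x n =
      (if a = l then z else 1) * G (some a) none +
        (if a = l then -(Φ / q) * (1 - q ^ 2) * z else 0) * G none (some l) := by
  by_cases h : a = l <;>
    simp [Fintype.sum_option, wt, ite_mul, h, add_comm]

theorem sum_wt_some_some (z : ℂ) (a : ZMod m) (G : Spin m → Spin m → ℂ) :
    ∑ x, ∑ n, wt m q Φ α l z (some a) (some l) x n * G x n =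
      (if a = l then Φ * q * z else Φ * α (-a) (-l)) * G (some a) (some l) := by
  by_cases h : a = l <;>
    simp [Fintype.sum_option, wt, ite_mul, h, ite_and]

end Sums

/-- unfused RTT Yang–Baxter equation: for every vertex color
`c_ℓ` (`ℓ ∈ {1, …, m}`) and all admissible boundary spins (the sums over the interior
spins `k`, `n` may be taken over all spins, since the T-weights vanish unless the
vertical spin lies in `{+, c_ℓ}`),
`∑ R^{(ℓ)}(a,b;i,j) wt_ℓ^{z₁}(i,c,d,k) wt_ℓ^{z₂}(j,k,e,f)
 = ∑ wt_ℓ^{z₂}(b,c,l,n) wt_ℓ^{z₁}(a,n,m',f) R^{(ℓ')}(m',l;d,e)` with `ℓ' ≡ ℓ+1 (mod m)`. -/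
theorem unfused_RTT_yang_baxter
    (m : ℕ) [NeZero m] (q Φ : ℂ) (hq : q ≠ 0) (hΦ : Φ ≠ 0)
    (α : ZMod m → ZMod m → ℂ) (hα : ∀ x y, α x y * α y x = 1) (hα1 : ∀ x, α x x = 1)
    (lNat : ℕ) (hl1 : 1 ≤ lNat) (hlm : lNat ≤ m)
    (z1 z2 : ℂ) (hz1 : z1 ≠ 0) (hz2 : z2 ≠ 0)
    (a b d e : Spin m) (c f : Spin m)
    (hc : c = none ∨ c = some ((lNat : ZMod m)))
    (hf : f = none ∨ f = some ((lNat : ZMod m))) :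
    (∑ i : Spin m, ∑ j : Spin m, ∑ k : Spin m,
        Runf m q Φ α (lNat : ZMod m) z1 z2 a b i j *
          wt m q Φ α (lNat : ZMod m) z1 i c d k *
          wt m q Φ α (lNat : ZMod m) z2 j k e f) =
      ∑ l : Spin m, ∑ m' : Spin m, ∑ n : Spin m,
        wt m q Φ α (lNat : ZMod m) z2 b c l n *
          wt m q Φ α (lNat : ZMod m) z1 a n m' f *
          Runf m q Φ α ((lNat : ZMod m) + 1) z1 z2 m' l d e := by
  generalize (lNat : ZMod m) = l at hc hf ⊢
  have hL : ∀ i j, ∑ k, Runf m q Φ α l z1 z2 a b i j * wt m q Φ α l z1 i c d k *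
      wt m q Φ α l z2 j k e f = Runf m q Φ α l z1 z2 a b i j *
      (wt m q Φ α l z1 i c d none * wt m q Φ α l z2 j none e f +
        wt m q Φ α l z1 i c d (some l) * wt m q Φ α l z2 j (some l) e f) := by
    intro i j
    rw [← sum_wt_bottom m q Φ α l z1 i c d fun k => wt m q Φ α l z2 j k e f, Finset.mul_sum]
    simp only [mul_assoc]
  have hR : ∀ x, ∑ y, ∑ n, wt m q Φ α l z2 b c x n * wt m q Φ α l z1 a n y f *
      Runf m q Φ α (l + 1) z1 z2 y x d e = ∑ n, wt m q Φ α l z2 b c x n *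
      ∑ y, wt m q Φ α l z1 a n y f * Runf m q Φ α (l + 1) z1 z2 y x d e := by
    intro x
    rw [Finset.sum_comm]
    simp only [mul_assoc, Finset.mul_sum]
  simp only [hL, hR]
  clear hL hR
  rcases a with _ | a <;> rcases b with _ | b
  · rcases hc with rfl | rfl <;> rcases hf with rfl | rfl <;>
      rcases d with _ | d <;> rcases e with _ | e <;>
      simp only [sum_Runf_none_none, sum_wt_none_none, sum_wt_none_some,
        sum_wt_right_none] <;>
      simp [wt, Runf] <;> grind
  · by_cases hb : b = l
    · subst hb
      rcases hc with rfl | rfl <;> rcases hf with rfl | rfl <;>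
        rcases d with _ | d <;> rcases e with _ | e <;>
        simp only [sum_Runf_none_some, sum_wt_some_none, sum_wt_some_some,
          sum_wt_right_none, Runf_self] <;>
        simp [wt, Runf] <;> grind
    · have hlb := Ne.symm hb
      have hα' := hα (-l) (-b)
      rcases hc with rfl | rfl <;> rcases hf with rfl | rfl <;>
        rcases d with _ | d <;> rcases e with _ | e <;>
        simp only [sum_Runf_none_some, sum_wt_some_none, sum_wt_some_some,
          sum_wt_right_none, Runf_colors _ _ _ _ _ _ _ hlb] <;>
        simp [wt, Runf, hb, not_precedes_add_one_left m hb] <;> grind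
  · by_cases ha : a = l
    · subst ha
      rcases hc with rfl | rfl <;> rcases hf with rfl | rfl <;>
        rcases d with _ | d <;> rcases e with _ | e <;>
        simp only [sum_Runf_some_none, sum_wt_none_none, sum_wt_none_some,
          sum_wt_right_some, Runf_self] <;>
        simp [wt, Runf] <;> grind
    · have hα' := hα (-l) (-a)
      rcases hc with rfl | rfl <;> rcases hf with rfl | rfl <;>
        rcases d with _ | d <;> rcases e with _ | e <;>
        simp only [sum_Runf_some_none, sum_wt_none_none, sum_wt_none_some,
          sum_wt_right_some, Runf_colors _ _ _ _ _ _ _ ha] <;>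
        simp [wt, Runf, ha, precedes_add_one_right m ha] <;> grind
  · by_cases hab : a = b
    · subst hab
      by_cases ha : a = l
      · subst ha
        rcases hc with rfl | rfl <;> rcases hf with rfl | rfl <;>
          rcases d with _ | d <;> rcases e with _ | e <;>
          simp only [sum_Runf_some_self, sum_wt_some_none, sum_wt_some_some,
            sum_wt_right_some, Runf_self] <;>
          simp [wt, Runf] <;> first | grind | (split_ifs <;> field_simp <;> ring)
      · rcases hc with rfl | rfl <;> rcases hf with rfl | rfl <;>
          rcases d with _ | d <;> rcases e with _ | e <;>
          simp only [sum_Runf_some_self, sum_wt_some_none, sum_wt_some_some,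
            sum_wt_right_some, Runf_self] <;>
          simp [wt, Runf, ha] <;> grind
    · by_cases ha : a = l
      · subst ha
        have hba := Ne.symm hab
        rcases hc with rfl | rfl <;> rcases hf with rfl | rfl <;>
          rcases d with _ | d <;> rcases e with _ | e <;>
          simp only [sum_Runf_some_some _ _ _ _ _ _ _ hab, sum_wt_some_none, sum_wt_some_some,
            sum_wt_right_some, Runf_colors _ _ _ _ _ _ _ hab] <;>
          simp [wt, Runf, hba, precedes_self_left m hba, not_precedes_add_one_left m hba] <;> grind
      · by_cases hb : b = l
        · subst hb
          rcases hc with rfl | rfl <;> rcases hf with rfl | rfl <;>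
            rcases d with _ | d <;> rcases e with _ | e <;>
            simp only [sum_Runf_some_some _ _ _ _ _ _ _ hab, sum_wt_some_none, sum_wt_some_some,
              sum_wt_right_some, Runf_colors _ _ _ _ _ _ _ hab] <;>
            simp [wt, Runf, hab, not_precedes_self_right, precedes_add_one_right m hab] <;> grind
        · rcases hc with rfl | rfl <;> rcases hf with rfl | rfl <;>
            rcases d with _ | d <;> rcases e with _ | e <;>
            simp only [sum_Runf_some_some _ _ _ _ _ _ _ hab, sum_wt_some_none, sum_wt_some_some,
              sum_wt_right_some, Runf_colors _ _ _ _ _ _ _ hab] <;>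
            simp [wt, Runf, ha, hb, precedes_add_one_iff m ha hb] <;> grind
end
end
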